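/- Let H be a DAT-free digraph. Then H admits a conservative binary polymorphism f such that for every pair of vertices u, v that is not an invertible pair, f(u,v) = f(v,u); consequently, for every non-invertible pair u, v the restriction of f to {u,v} is a semilattice (commutative and associative). -/

import Mathlib

variable {V : Type*}

/-- A `+` arc of the pair digraph `H⁺`: from `(u,v)` to `(u',v')` when
`uu' ∈ E`, `vv' ∈ E` and `uv' ∉ E`. -/
def PlusArc (E : V → V → Prop) (p q : V × V) : Prop :=
  E p.1 q.1 ∧ E p.2 q.2 ∧ ¬ E p.1 q.2

/-- A `−` arc of the pair digraph `H⁺`: from `(u,v)` to `(u',v')` when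
`u'u ∈ E`, `v'v ∈ E` and `v'u ∉ E`. -/
def MinusArc (E : V → V → Prop) (p q : V × V) : Prop :=
  E q.1 p.1 ∧ E q.2 p.2 ∧ ¬ E q.2 p.1

/-- The arc relation of the pair digraph `H⁺`. -/
def HPlusArc (E : V → V → Prop) (p q : V × V) : Prop :=
  PlusArc E p q ∨ MinusArc E p q

/-- `x 0, x 1, ..., x n` is a walk in the digraph `E` with pattern `ε`:
step `i` is a forward arc if `ε i = true` and a backward arc if `ε i = false`.
Two walks are congruent iff they have the same length `n` and the same pattern `ε`. -/
def IsWalkOn (E : V → V → Prop) (n : ℕ) (x : ℕ → V) (ε : ℕ → Bool) : Prop :=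
  ∀ i < n, if ε i = true then E (x i) (x (i + 1)) else E (x (i + 1)) (x i)

/-- The walk `x` avoids the congruent walk `y` (common pattern `ε`, length `n`):
there is no arc from `x i` to `y (i+1)` in the direction of step `i`. -/
def AvoidsOn (E : V → V → Prop) (n : ℕ) (x y : ℕ → V) (ε : ℕ → Bool) : Prop :=
  ∀ i < n, if ε i = true then ¬ E (x i) (y (i + 1)) else ¬ E (y (i + 1)) (x i)

/-- `u, v` is an invertible pair: there are congruent walks `P : u → v`, `Q : v → u`
with `P` avoiding `Q`, and congruent walks `P' : v → u`, `Q' : u → v` with `P'`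
avoiding `Q'`. -/
def InvertiblePair (E : V → V → Prop) (u v : V) : Prop :=
  (∃ (n : ℕ) (x y : ℕ → V) (ε : ℕ → Bool),
      IsWalkOn E n x ε ∧ IsWalkOn E n y ε ∧
      x 0 = u ∧ x n = v ∧ y 0 = v ∧ y n = u ∧ AvoidsOn E n x y ε) ∧
  (∃ (n : ℕ) (x y : ℕ → V) (ε : ℕ → Bool),
      IsWalkOn E n x ε ∧ IsWalkOn E n y ε ∧
      x 0 = v ∧ x n = u ∧ y 0 = u ∧ y n = v ∧ AvoidsOn E n x y ε)

/-- The witnessing condition of a permutable triple, for the vertex `x` of the triple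
`x, y, z`: there are mutually congruent walks `P : x → sx`, `Q : y → bx`, `R : z → bx`
such that `P` avoids both `Q` and `R`. -/
def TripleWitness (E : V → V → Prop) (x y z sx bx : V) : Prop :=
  ∃ (n : ℕ) (ε : ℕ → Bool) (P Q R : ℕ → V),
    IsWalkOn E n P ε ∧ IsWalkOn E n Q ε ∧ IsWalkOn E n R ε ∧
    P 0 = x ∧ P n = sx ∧ Q 0 = y ∧ Q n = bx ∧ R 0 = z ∧ R n = bx ∧
    AvoidsOn E n P Q ε ∧ AvoidsOn E n P R ε

/-- `u, v, w` (distinct) form a permutable triple with witnesses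
`su, bu, sv, bv, sw, bw`. -/
def PermutableWitnesses (E : V → V → Prop) (u v w su bu sv bv sw bw : V) : Prop :=
  u ≠ v ∧ u ≠ w ∧ v ≠ w ∧
  TripleWitness E u v w su bu ∧ TripleWitness E v u w sv bv ∧ TripleWitness E w u v sw bw

/-- `H` has a permutable triple. -/
def HasPermutableTriple (E : V → V → Prop) : Prop :=
  ∃ u v w su bu sv bv sw bw : V, PermutableWitnesses E u v w su bu sv bv sw bw

/-- A digraph asteroidal triple (DAT): a permutable triple in which each of the
three pairs `(su,bu)`, `(sv,bv)`, `(sw,bw)` is invertible. -/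
def IsDAT (E : V → V → Prop) (u v w su bu sv bv sw bw : V) : Prop :=
  PermutableWitnesses E u v w su bu sv bv sw bw ∧
  InvertiblePair E su bu ∧ InvertiblePair E sv bv ∧ InvertiblePair E sw bw

/-- `H` is DAT-free. -/
def DATFree (E : V → V → Prop) : Prop :=
  ¬ ∃ u v w su bu sv bv sw bw : V, IsDAT E u v w su bu sv bv sw bw

/-- `f` is a binary polymorphism of the digraph `E`. -/
def BinPoly (E : V → V → Prop) (f : V → V → V) : Prop :=
  ∀ a b a' b', E a a' → E b b' → E (f a b) (f a' b')

/-- A binary operation is conservative. -/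
def BinConservative (f : V → V → V) : Prop :=
  ∀ a b, f a b = a ∨ f a b = b

/-- `g` is a ternary polymorphism of the digraph `E`. -/
def TerPoly (E : V → V → Prop) (g : V → V → V → V) : Prop :=
  ∀ a b c a' b' c', E a a' → E b b' → E c c' → E (g a b c) (g a' b' c')

/-- A ternary operation is conservative. -/
def TerConservative (g : V → V → V → V) : Prop :=
  ∀ a b c, g a b c = a ∨ g a b c = b ∨ g a b c = c

theorem hplus_swap (E : V → V → Prop) (p q : V × V) (h : HPlusArc E p q) :
    HPlusArc E q.swap p.swap := by
  rcases h with ⟨a, b, c⟩ | ⟨a, b, c⟩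
  · exact Or.inr ⟨b, a, c⟩
  · exact Or.inl ⟨b, a, c⟩

theorem reach_swap (E : V → V → Prop) {p q : V × V}
    (h : Relation.ReflTransGen (HPlusArc E) p q) :
    Relation.ReflTransGen (HPlusArc E) q.swap p.swap := by
  induction h with
  | refl => exact .refl
  | tail _ hbc ih => exact .head (hplus_swap E _ _ hbc) ih

theorem reach_walk (E : V → V → Prop) {p q : V × V}
    (h : Relation.ReflTransGen (HPlusArc E) p q) :
    ∃ (n : ℕ) (x y : ℕ → V) (ε : ℕ → Bool),
      IsWalkOn E n x ε ∧ IsWalkOn E n y ε ∧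
      x 0 = p.1 ∧ x n = q.1 ∧ y 0 = p.2 ∧ y n = q.2 ∧ AvoidsOn E n x y ε := by
  induction h using Relation.ReflTransGen.head_induction_on with
  | refl =>
    refine ⟨0, fun _ => q.1, fun _ => q.2, fun _ => true, ?_, ?_, rfl, rfl, rfl, rfl, ?_⟩ <;>
      intro i hi <;> omega
  | @head a c hac _ ih =>
    obtain ⟨n, x, y, ε, hx, hy, x0, xn, y0, yn, hav⟩ := ih
    have key : ∃ b : Bool, (if b = true then E a.1 c.1 else E c.1 a.1) ∧
        (if b = true then E a.2 c.2 else E c.2 a.2) ∧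
        (if b = true then ¬ E a.1 c.2 else ¬ E c.2 a.1) := by
      rcases hac with ⟨h1, h2, h3⟩ | ⟨h1, h2, h3⟩
      · exact ⟨true, by simpa using ⟨h1, h2, h3⟩⟩
      · exact ⟨false, by simpa using ⟨h1, h2, h3⟩⟩
    obtain ⟨b, h1, h2, h3⟩ := key
    refine ⟨n + 1, fun i => Nat.casesOn i a.1 x, fun i => Nat.casesOn i a.2 y,
      fun i => Nat.casesOn i b ε, ?_, ?_, rfl, xn, rfl, yn, ?_⟩
    · rintro (_ | i) hi
      · simpa [x0] using h1
      · exact hx i (by omega)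
    · rintro (_ | i) hi
      · simpa [y0] using h2
      · exact hy i (by omega)
    · rintro (_ | i) hi
      · simpa [y0] using h3
      · exact hav i (by omega)

theorem reach_invertible (E : V → V → Prop) (p : V × V)
    (h1 : Relation.ReflTransGen (HPlusArc E) p p.swap)
    (h2 : Relation.ReflTransGen (HPlusArc E) p.swap p) : InvertiblePair E p.1 p.2 :=
  ⟨reach_walk E h1, reach_walk E h2⟩

theorem invertible_symm (E : V → V → Prop) (u v : V) (h : InvertiblePair E u v) :
    InvertiblePair E v u := ⟨h.2, h.1⟩

/-- Sets of ordered pairs closed under arcs of `H⁺`, containing at most one orientation of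
each non-invertible pair. -/
def GoodSet (E : V → V → Prop) (A : Set (V × V)) : Prop :=
  (∀ p q, HPlusArc E p q → p ∈ A → q ∈ A) ∧
  ∀ p : V × V, ¬ InvertiblePair E p.1 p.2 → p ∈ A → p.swap ∉ A

theorem good_reach (E : V → V → Prop) {A : Set (V × V)} (hA : GoodSet E A) {p q : V × V}
    (h : Relation.ReflTransGen (HPlusArc E) p q) (hp : p ∈ A) : q ∈ A := by
  induction h with
  | refl => exact hp
  | tail _ hbc ih => exact hA.1 _ _ hbc ih

theorem good_extend (E : V → V → Prop) {A : Set (V × V)} (hA : GoodSet E A) (p : V × V)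
    (hps : p.swap ∉ A) (hr : ¬ Relation.ReflTransGen (HPlusArc E) p p.swap) :
    GoodSet E (A ∪ {q | Relation.ReflTransGen (HPlusArc E) p q}) := by
  refine ⟨?_, ?_⟩
  · rintro q r hqr (hq | hq)
    · exact Or.inl (hA.1 _ _ hqr hq)
    · exact Or.inr (Relation.ReflTransGen.tail hq hqr)
  · rintro q hn (hq | hq) (hs | hs)
    · exact hA.2 q hn hq hs
    · have h := reach_swap E (show Relation.ReflTransGen (HPlusArc E) p q.swap from hs)
      rw [Prod.swap_swap] at h
      exact hps (good_reach E hA h hq)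
    · exact hps (good_reach E hA (reach_swap E hq) hs)
    · have h := reach_swap E (show Relation.ReflTransGen (HPlusArc E) p q.swap from hs)
      rw [Prod.swap_swap] at h
      exact hr (Relation.ReflTransGen.trans hq h)

theorem exists_good (E : V → V → Prop) : ∃ A : Set (V × V), GoodSet E A ∧
    ∀ p : V × V, ¬ InvertiblePair E p.1 p.2 → p ∈ A ∨ p.swap ∈ A := by
  obtain ⟨A, hA⟩ := zorn_subset {A | GoodSet E A} (by
    intro c hc hch
    refine ⟨⋃₀ c, ⟨?_, ?_⟩, fun s hs => Set.subset_sUnion_of_mem hs⟩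
    · rintro p q hpq ⟨s, hs, hp⟩
      exact ⟨s, hs, (hc hs).1 p q hpq hp⟩
    · rintro p hn ⟨s, hs, hp⟩ ⟨t, ht, hq⟩
      rcases hch.total hs ht with h | h
      · exact (hc ht).2 p hn (h hp) hq
      · exact (hc hs).2 p hn hp (h hq))
  have hg : GoodSet E A := hA.prop
  have key : ∀ p : V × V, p ∉ A → p.swap ∉ A →
      Relation.ReflTransGen (HPlusArc E) p p.swap := by
    intro p hp hps
    by_contra hr
    have h := hA.le_of_ge (good_extend E hg p hps hr) Set.subset_union_left
    exact hp (h (Or.inr .refl))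
  refine ⟨A, hg, fun p hn => ?_⟩
  by_contra hcon
  rw [not_or] at hcon
  refine hn (reach_invertible E p (key p hcon.1 hcon.2) ?_)
  simpa using key p.swap hcon.2 (by simpa using hcon.1)

/-- A DAT-free digraph admits a conservative binary polymorphism `f` with
`f u v = f v u` for every non-invertible pair `u, v`; consequently, on every
non-invertible pair the restriction of `f` to `{u,v}` is a semilattice
(commutative and associative). -/
theorem datfree_binary_semilattice (E : V → V → Prop) (hfree : DATFree E) :
    ∃ f : V → V → V, BinPoly E f ∧ BinConservative f ∧
      ∀ u v : V, ¬ InvertiblePair E u v →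
        (f u v = f v u ∧
         ∀ a ∈ ({u, v} : Set V), ∀ b ∈ ({u, v} : Set V), ∀ c ∈ ({u, v} : Set V),
           f a b ∈ ({u, v} : Set V) ∧ f a b = f b a ∧ f a (f b c) = f (f a b) c) := by
  classical
  obtain ⟨A, hA, hT⟩ := exists_good E
  have hcons : ∀ a b : V, (if (a, b) ∈ A then a else b) = a ∨
      (if (a, b) ∈ A then a else b) = b := by
    intro a b
    split_ifs
    · exact Or.inl rfl
    · exact Or.inr rfl
  have hcomm : ∀ u v : V, ¬ InvertiblePair E u v →
      (if (u, v) ∈ A then u else v) = (if (v, u) ∈ A then v else u) := by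
    intro u v hn
    by_cases h : (u, v) ∈ A
    · have h' : (v, u) ∉ A := hA.2 (u, v) hn h
      simp [h, h']
    · have h' : (v, u) ∈ A := (hT (u, v) hn).resolve_left h
      simp [h, h']
  refine ⟨fun u v => if (u, v) ∈ A then u else v, ?_, hcons, ?_⟩
  · intro a b a' b' h1 h2
    show E (if (a, b) ∈ A then a else b) (if (a', b') ∈ A then a' else b')
    split_ifs with h3 h4 h4
    · exact h1
    · by_contra h
      exact h4 (hA.1 (a, b) (a', b') (Or.inl ⟨h1, h2, h⟩) h3)
    · by_contra h
      exact h3 (hA.1 (a', b') (a, b) (Or.inr ⟨h1, h2, h⟩) h4)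
    · exact h2
  · intro u v hn
    have huv := hcomm u v hn
    refine ⟨huv, ?_⟩
    generalize hf : (fun u v : V => if (u, v) ∈ A then u else v) = f
    have hc : ∀ a b, f a b = a ∨ f a b = b := by subst hf; exact hcons
    have huv' : f u v = f v u := by subst hf; exact huv
    have hid : ∀ a, f a a = a := fun a => by simpa using hc a a
    have hu := hid u
    have hv := hid v
    clear hf hcons hcomm huv hT
    have hm := hc u v
    intro a ha b hb c hc'
    simp only [Set.mem_insert_iff, Set.mem_singleton_iff] at ha hb hc' ⊢
    clear hc
    rcases hm with h | h <;> rcases ha with ha | ha <;> rcases hb with hb | hb <;>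
      rcases hc' with hc' | hc' <;> rw [h] at huv' <;> rw [ha, hb, hc'] <;>
      simp [h, ← huv', hu, hv]
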